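/- For each p > 0 and each locally finite metric space (Z,d), there exists a Lipschitz injection of Z into ℓ_p: an injective map f : Z → ℓ_p with d_p(f(x), f(y)) ≤ d(x,y) for all x, y ∈ Z, where d_p is the metric of ℓ_p. -/

import Mathlib

/-- A metric space is locally finite if all of its bounded subsets are finite. -/
def LocallyFiniteSpace (Z : Type*) [MetricSpace Z] : Prop :=
  ∀ s : Set Z, Bornology.IsBounded s → s.Finite

/-- The metric of `ℓ_p` applied to two sequences `u, v : ℕ → ℝ`:
for `0 < p ≤ 1` it is `Σ_n |u n − v n|^p`, and for `p ≥ 1` it is the norm metric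
`(Σ_n |u n − v n|^p)^{1/p}`. -/
noncomputable def ellPDist (p : ℝ) (u v : ℕ → ℝ) : ℝ :=
  if p ≤ 1 then ∑' n : ℕ, |u n - v n| ^ p
  else (∑' n : ℕ, |u n - v n| ^ p) ^ (1 / p)

lemma LocallyFiniteSpace.countable {Z : Type*} [MetricSpace Z] (hZ : LocallyFiniteSpace Z) :
    Countable Z := by
  rcases isEmpty_or_nonempty Z with h | ⟨⟨z⟩⟩
  · infer_instance
  · rw [← Set.countable_univ_iff, ← Metric.iUnion_closedBall_nat z]
    exact Set.countable_iUnion fun n => (hZ _ Metric.isBounded_closedBall).countable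

lemma LocallyFiniteSpace.exists_pos_le_dist {Z : Type*} [MetricSpace Z]
    (hZ : LocallyFiniteSpace Z) (z : Z) : ∃ ε > 0, ∀ w, w ≠ z → ε ≤ dist z w := by
  have hfin : (Metric.ball z 1 \ {z}).Finite := (hZ _ Metric.isBounded_ball).subset Set.sdiff_subset
  obtain ⟨ε, hε, hsub⟩ := Metric.isOpen_iff.1 hfin.isClosed.isOpen_compl z (by simp)
  refine ⟨min ε 1, lt_min hε one_pos, fun w hw => ?_⟩
  by_contra! hlt
  rw [dist_comm, lt_min_iff] at hlt
  exact hsub (Metric.mem_ball.2 hlt.1) ⟨Metric.mem_ball.2 hlt.2, hw⟩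

lemma LocallyFiniteSpace.exists_pos_add_le_dist {Z : Type*} [MetricSpace Z]
    (hZ : LocallyFiniteSpace Z) :
    ∃ ρ : Z → ℝ, (∀ z, 0 < ρ z) ∧ ∀ z w, z ≠ w → ρ z + ρ w ≤ dist z w := by
  choose ε hε h using hZ.exists_pos_le_dist
  refine ⟨fun z => ε z / 2, fun z => half_pos (hε z), fun z w hzw => ?_⟩
  have h₁ := h z w hzw.symm
  have h₂ := h w z hzw
  rw [dist_comm] at h₂
  linarith

lemma hasSum_abs_single_rpow {p : ℝ} (hp : 0 < p) (i : ℕ) {a : ℝ} (ha : 0 ≤ a) :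
    HasSum (fun n => |(Pi.single i a : ℕ → ℝ) n| ^ p) (a ^ p) := by
  convert hasSum_pi_single i (a ^ p) using 1
  ext n
  rcases eq_or_ne n i with rfl | h
  · simp [abs_of_nonneg ha]
  · simp [h, Real.zero_rpow hp.ne']

lemma hasSum_abs_single_sub_single_rpow {p : ℝ} (hp : 0 < p) {i j : ℕ} (hij : i ≠ j) {a b : ℝ}
    (ha : 0 ≤ a) (hb : 0 ≤ b) :
    HasSum (fun n => |(Pi.single i a : ℕ → ℝ) n - (Pi.single j b : ℕ → ℝ) n| ^ p)
      (a ^ p + b ^ p) := by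
  convert (hasSum_abs_single_rpow hp i ha).add (hasSum_abs_single_rpow hp j hb) using 1
  ext n
  rcases eq_or_ne n i with rfl | h
  · simp [hij, Real.zero_rpow hp.ne']
  · simp [h, Real.zero_rpow hp.ne']

lemma ellPDist_self {p : ℝ} (hp : 0 < p) (u : ℕ → ℝ) : ellPDist p u u = 0 := by
  simp [ellPDist, Real.zero_rpow hp.ne', hp.ne']

/-- a consequence of Theorem 7 of the paper: for each `p > 0` and
each locally finite metric space `(Z,d)` there is a Lipschitz injection of order `1`
of `Z` into `ℓ_p`. -/
theorem locally_finite_lipschitz_injects_into_ell_p (p : ℝ) (hp : 0 < p)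
    {Z : Type*} [MetricSpace Z] (hZ : LocallyFiniteSpace Z) :
    ∃ f : Z → ℕ → ℝ, Function.Injective f ∧
      (∀ x : Z, Summable fun n : ℕ => |f x n| ^ p) ∧
      ∀ x y : Z, Summable (fun n : ℕ => |f x n - f y n| ^ p) ∧
        ellPDist p (f x) (f y) ≤ dist x y := by
  obtain ⟨ρ, hρ, hdist⟩ := hZ.exists_pos_add_le_dist
  have := hZ.countable
  obtain ⟨g, hg⟩ := exists_injective_nat Z
  obtain ⟨c, hc, hle⟩ : ∃ c : Z → ℝ, (∀ z, 0 < c z) ∧ ∀ z w, z ≠ w →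
      (if p ≤ 1 then c z ^ p + c w ^ p else (c z ^ p + c w ^ p) ^ (1 / p)) ≤ dist z w := by
    by_cases h : p ≤ 1
    · refine ⟨fun z => ρ z ^ p⁻¹, fun z => Real.rpow_pos_of_pos (hρ z) _, fun z w hzw => ?_⟩
      simpa only [if_pos h, Real.rpow_inv_rpow (hρ _).le hp.ne'] using hdist z w hzw
    · refine ⟨ρ, hρ, fun z w hzw => ?_⟩
      rw [if_neg h]
      exact (Real.rpow_add_rpow_le_add (hρ z).le (hρ w).le (not_le.1 h).le).trans (hdist z w hzw)
  refine ⟨fun z => Pi.single (g z) (c z), fun x y hxy => ?_,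
    fun x => (hasSum_abs_single_rpow hp _ (hc x).le).summable, fun x y => ?_⟩
  · by_contra hne
    have h := congrFun hxy (g x)
    simp only [Pi.single_eq_same, Pi.single_eq_of_ne (hg.ne hne)] at h
    exact (hc x).ne' h
  · rcases eq_or_ne x y with rfl | hne
    · refine ⟨?_, (ellPDist_self hp _).trans_le dist_nonneg⟩
      simp [Real.zero_rpow hp.ne', summable_zero]
    · have h := hasSum_abs_single_sub_single_rpow hp (hg.ne hne) (hc x).le (hc y).le
      refine ⟨h.summable, ?_⟩
      rw [ellPDist, h.tsum_eq]
      exact hle x y hne
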